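/- arXiv:1110.2630 — 2 statements merged into one kernel-verified Lean document; each statement's English description precedes it below -/
import Mathlib

section
/- Let k be a field and q ∈ k a nonzero scalar with q² ≠ 1. Let A be an associative k-algebra containing elements e_1,…,e_N, f_1,…,f_N and invertible elements K_1,…,K_N satisfying the defining relations of U_q(gl): the K_a commute pairwise; K_a e_b K_a⁻¹ = q^{a_{ab}} e_b and K_a f_b K_a⁻¹ = q^{−a_{ab}} f_b, where a_{ab} = 2 if a = b, a_{ab} = −1 if |a−b| = 1, and a_{ab} = 0 otherwise; e_a f_b − f_b e_a = δ_{ab}(K_a − K_a⁻¹)/(q − q⁻¹); and the f_a satisfy the q-Serre relations of type A (f_a f_b = f_b f_a for |a−b| ≥ 2, and f_a² f_b − (q+q⁻¹) f_a f_b f_a + f_b f_a² = 0 for |a−b| = 1). For 1 ≤ i < j ≤ N set f_μ := [f_i,[f_{i+1},…,[f_{j−1},f_j]_q…]_q]_q and f̃_μ := [f_i,[f_{i+1},…,[f_{j−1},f_j]_{q⁻¹}…]_{q⁻¹}]_{q⁻¹}, and let f_{μ'}, f̃_{μ'} (resp. f_{μ''}, f̃_{μ''}) be defined in the same way from the generator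 range i+1,…,j (resp. i,…,j−1). Then: (a) [e_k, f_μ] = 0 and [e_k, f̃_μ] = 0 for every k with i < k < j; (b) [e_i, f_μ] = f_{μ'}·K_i⁻¹; (c) [e_j, f_μ] = −q·f_{μ''}·K_j; (d) [e_i, f̃_μ] = f̃_{μ'}·K_i; (e) [e_j, f̃_μ] = −q⁻¹·f̃_{μ''}·K_j⁻¹. -/
/-- The deformed commutator `[u,v]_t = u·v − t·v·u`. -/
def qComm {k A : Type*} [CommRing k] [Ring A] [Algebra k A] (t : k) (u v : A) : A :=
  u * v - t • (v * u)

/-- The iterated deformed commutator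
`[f i, [f (i+1), …, [f (j−1), f j]_t …]_t]_t` (innermost `[f (j−1), f j]_t`). -/
def iterQComm {k A : Type*} [CommRing k] [Ring A] [Algebra k A]
    (t : k) (f : ℕ → A) (i j : ℕ) : A :=
  (List.range' i (j - i)).foldr (fun a acc => qComm t (f a) acc) (f j)

/-- The Cartan matrix of type `A`: `a_{ab} = 2` if `a = b`, `−1` if `|a−b| = 1`,
`0` otherwise. -/
def cartanA (a b : ℕ) : ℤ :=
  if a = b then 2 else if a + 1 = b ∨ b + 1 = a then -1 else 0


section CoreLemmas
variable {k A : Type*} [Field k] [Ring A] [Algebra k A]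

theorem iter_self (t : k) (f : ℕ → A) (j : ℕ) : iterQComm t f j j = f j := by
  simp [iterQComm]

theorem iter_step (t : k) (f : ℕ → A) (i j : ℕ) (h : i < j) :
    iterQComm t f i j = qComm t (f i) (iterQComm t f (i + 1) j) := by
  obtain ⟨n, rfl⟩ := Nat.exists_eq_add_of_lt h
  have h1 : i + n + 1 - i = n + 1 := by omega
  have h2 : i + n + 1 - (i + 1) = n := by omega
  simp [iterQComm, h1, h2, List.range'_succ]

theorem comm_qComm (t : k) (x u v : A) (hu : x * u = u * x) (hv : x * v = v * x) :
    x * qComm t u v = qComm t u v * x := by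
  have h1 : x * (u * v) = u * v * x := by rw [← mul_assoc, hu, mul_assoc, hv, mul_assoc]
  have h2 : x * (v * u) = v * u * x := by rw [← mul_assoc, hv, mul_assoc, hu, mul_assoc]
  simp only [qComm, mul_sub, sub_mul, mul_smul_comm, smul_mul_assoc, h1, h2]

theorem comm_iter (t : k) (f : ℕ → A) (x : A) (n : ℕ) : ∀ i,
    (∀ b, i ≤ b → b ≤ i + n → x * f b = f b * x) →
    x * iterQComm t f i (i + n) = iterQComm t f i (i + n) * x := by
  induction n with
  | zero => intro i h; simpa [iter_self] using h i le_rfl le_rfl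
  | succ n ih =>
    intro i h
    rw [iter_step t f i _ (by omega)]
    apply comm_qComm _ _ _ _ (h i le_rfl (by omega))
    have := ih (i + 1) (fun b h1 h2 => h b (by omega) (by omega))
    rwa [show i + 1 + n = i + (n + 1) by omega] at this

theorem comm_iter' (t : k) (f : ℕ → A) (x : A) (i j : ℕ) (hij : i ≤ j)
    (h : ∀ b, i ≤ b → b ≤ j → x * f b = f b * x) :
    x * iterQComm t f i j = iterQComm t f i j * x := by
  obtain ⟨n, rfl⟩ := Nat.exists_eq_add_of_le hij
  exact comm_iter t f x n i h

/-- `x` scales the first generator by `s` and commutes with the rest. -/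
theorem scale_iter (t s : k) (f : ℕ → A) (x : A) (i j : ℕ) (hij : i ≤ j)
    (h0 : x * f i = s • (f i * x))
    (h : ∀ b, i < b → b ≤ j → x * f b = f b * x) :
    x * iterQComm t f i j = s • (iterQComm t f i j * x) := by
  rcases hij.eq_or_lt with rfl | hlt
  · simpa [iter_self] using h0
  · rw [iter_step t f i j hlt]
    have hY := comm_iter' t f x (i + 1) j hlt (fun b h1 h2 => h b h1 h2)
    set Y := iterQComm t f (i + 1) j
    have h1 : x * (f i * Y) = s • (f i * Y * x) := by
      rw [← mul_assoc, h0, smul_mul_assoc, mul_assoc, hY, mul_assoc]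
    have h2 : x * (Y * f i) = s • (Y * f i * x) := by
      rw [← mul_assoc, hY, mul_assoc, h0, mul_smul_comm, mul_assoc]
    simp only [qComm, mul_sub, sub_mul, mul_smul_comm, smul_mul_assoc, h1, h2]
    module

/-- The bracket `[e, [u,v]_t]` when `e` commutes with `v`. -/
theorem br_left (t : k) (e u v H : A) (hu : e * u - u * e = H) (hv : e * v = v * e) :
    e * qComm t u v - qComm t u v * e = H * v - t • (v * H) := by
  subst hu
  have h1 : u * e * v = u * v * e := by rw [mul_assoc, hv, mul_assoc]
  have h2 : e * (v * u) = v * (e * u) := by rw [← mul_assoc, hv, mul_assoc]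
  simp only [qComm, mul_sub, sub_mul, mul_smul_comm, smul_mul_assoc, h1, h2, smul_sub,
    mul_assoc] 
  abel

theorem br_right (t : k) (e u v H : A) (hu : e * u = u * e) (hv : e * v - v * e = H) :
    e * qComm t u v - qComm t u v * e = u * H - t • (H * u) := by
  subst hv
  have h1 : e * (u * v) = u * (e * v) := by rw [← mul_assoc, hu, mul_assoc]
  have h2 : v * e * u = v * u * e := by rw [mul_assoc, hu, mul_assoc]
  simp only [qComm, mul_sub, sub_mul, mul_smul_comm, smul_mul_assoc, h1, h2, smul_sub,
    mul_assoc] 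
  abel

theorem core
    (q : k) (hq0 : q ≠ 0) (hq2 : q ^ 2 ≠ 1)
    (N : ℕ) (e f K L : ℕ → A)
    (hKf : ∀ a b, 1 ≤ a → a ≤ N → 1 ≤ b → b ≤ N →
      K a * f b = q ^ (-(cartanA a b)) • (f b * K a))
    (hLf : ∀ a b, 1 ≤ a → a ≤ N → 1 ≤ b → b ≤ N →
      L a * f b = q ^ (cartanA a b) • (f b * L a))
    (hef : ∀ a b, 1 ≤ a → a ≤ N → 1 ≤ b → b ≤ N → a ≠ b →
      e a * f b = f b * e a)
    (hefa : ∀ a, 1 ≤ a → a ≤ N →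
      e a * f a - f a * e a = (q - q⁻¹)⁻¹ • (K a - L a))
    (hcomm : ∀ a b, 1 ≤ a → a ≤ N → 1 ≤ b → b ≤ N → (a + 2 ≤ b ∨ b + 2 ≤ a) →
      f a * f b = f b * f a)
    (j : ℕ) (hj : j ≤ N) :
    (∀ i, 1 ≤ i → i < j → e i * iterQComm q f i j - iterQComm q f i j * e i
      = iterQComm q f (i + 1) j * L i) ∧
    (∀ i m, 1 ≤ i → i < m → m < j →
      e m * iterQComm q f i j - iterQComm q f i j * e m = 0) ∧
    (∀ i, 1 ≤ i → i < j → e j * iterQComm q f i j - iterQComm q f i j * e j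
      = -(q • (iterQComm q f i (j - 1) * K j))) := by
  have hd : q ^ 2 - 1 ≠ 0 := sub_ne_zero.2 hq2
  have hqq : q - q⁻¹ ≠ 0 := by
    intro h
    apply hd
    field_simp at h
    simpa using h
  have B : ∀ i, 1 ≤ i → i < j → e i * iterQComm q f i j - iterQComm q f i j * e i
      = iterQComm q f (i + 1) j * L i := by
    intro i hi hij
    have hE := comm_iter' q f (e i) (i + 1) j hij
      (fun b h1 h2 => hef i b hi (by omega) (by omega) (by omega) (by omega))
    have hK := scale_iter q q f (K i) (i + 1) j hij
      (by simpa [cartanA] using hKf i (i+1) hi (by omega) (by omega) (by omega))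
      (fun b h1 h2 => by
        have := hKf i b hi (by omega) (by omega) (by omega)
        have c : cartanA i b = 0 := by
          unfold cartanA; rw [if_neg (by omega), if_neg (by omega)]
        simpa [c] using this)
    have hL := scale_iter q q⁻¹ f (L i) (i + 1) j hij
      (by simpa [cartanA] using hLf i (i+1) hi (by omega) (by omega) (by omega))
      (fun b h1 h2 => by
        have := hLf i b hi (by omega) (by omega) (by omega)
        have c : cartanA i b = 0 := by
          unfold cartanA; rw [if_neg (by omega), if_neg (by omega)]
        simpa [c] using this)
    rw [iter_step q f i j hij, br_left q _ _ _ _ (hefa i hi (by omega)) hE]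
    simp only [mul_smul_comm, smul_mul_assoc, mul_sub, sub_mul, hK, hL]
    match_scalars
    · field_simp; ring
    · field_simp; ring
  refine ⟨B, ?_, ?_⟩
  · intro i m hi him hmj
    have key : ∀ n i, 1 ≤ i → i + n + 1 = m →
        e m * iterQComm q f i j - iterQComm q f i j * e m = 0 := by
      intro n
      induction n with
      | zero =>
        intro i hi h
        have hm : m = i + 1 := by omega
        subst hm
        rw [iter_step q f i j (by omega), br_right q _ _ _ _
          (hef (i+1) i (by omega) (by omega) (by omega) (by omega) (by omega))
          (B (i+1) (by omega) hmj)]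
        have hX := comm_iter' q f (f i) (i + 1 + 1) j hmj
          (fun b h1 h2 => hcomm i b hi (by omega) (by omega) (by omega) (by omega))
        have hL : L (i+1) * f i = q⁻¹ • (f i * L (i+1)) := by
          simpa [cartanA] using hLf (i+1) i (by omega) (by omega) (by omega) (by omega)
        rw [mul_assoc, hL, ← mul_assoc, hX, mul_smul_comm, smul_smul, mul_inv_cancel₀ hq0,
          one_smul, mul_assoc, sub_self]
      | succ n ih =>
        intro i hi h
        rw [iter_step q f i j (by omega), br_right q _ _ _ _
          (hef m i (by omega) (by omega) (by omega) (by omega) (by omega))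
          (ih (i+1) (by omega) (by omega))]
        simp
    exact key (m - i - 1) i hi (by omega)
  · intro i hi hij
    have key : ∀ n i, 1 ≤ i → i + n + 1 = j →
        e j * iterQComm q f i j - iterQComm q f i j * e j
          = -(q • (iterQComm q f i (j - 1) * K j)) := by
      intro n
      induction n with
      | zero =>
        intro i hi h
        have hm : j = i + 1 := by omega
        subst hm
        rw [iter_step q f i _ (by omega), iter_self, br_right q _ _ _ _
          (hef (i+1) i (by omega) (by omega) (by omega) (by omega) (by omega))
          (hefa (i+1) (by omega) hj), Nat.add_sub_cancel, iter_self]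
        have hK : K (i+1) * f i = q • (f i * K (i+1)) := by
          simpa [cartanA] using hKf (i+1) i (by omega) (by omega) (by omega) (by omega)
        have hL : L (i+1) * f i = q⁻¹ • (f i * L (i+1)) := by
          simpa [cartanA] using hLf (i+1) i (by omega) (by omega) (by omega) (by omega)
        simp only [mul_smul_comm, smul_mul_assoc, mul_sub, sub_mul, hK, hL]
        match_scalars
        · field_simp; ring
        · field_simp; ring
      | succ n ih =>
        intro i hi h
        have hK : K j * f i = f i * K j := by
          have := hKf j i (by omega) (by omega) (by omega) (by omega)
          have c : cartanA j i = 0 := by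
            unfold cartanA; rw [if_neg (by omega), if_neg (by omega)]
          simpa [c] using this
        rw [iter_step q f i j (by omega), br_right q _ _ _ _
          (hef j i (by omega) (by omega) (by omega) (by omega) (by omega))
          (ih (i+1) (by omega) (by omega)), iter_step q f i (j-1) (by omega)]
        simp only [qComm, mul_smul_comm, smul_mul_assoc, mul_sub, sub_mul, mul_neg, neg_mul,
          mul_assoc, hK]
        module
    exact key (j - i - 1) i hi (by omega)

end CoreLemmas

/-- in `U_q(gl)`, commutation relations of the positive Chevalley
generators with the composite root vectors `f_μ` and `f̃_μ`. -/
theorem chevalley_commutation_with_root_vectors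
    {k A : Type*} [Field k] [Ring A] [Algebra k A]
    (q : k) (hq0 : q ≠ 0) (hq2 : q ^ 2 ≠ 1)
    (N : ℕ) (e f : ℕ → A) (K : ℕ → Aˣ)
    (hKcomm : ∀ a b, (K a : A) * (K b : A) = (K b : A) * (K a : A))
    (hKe : ∀ a b, 1 ≤ a → a ≤ N → 1 ≤ b → b ≤ N →
      (K a : A) * e b * (↑(K a)⁻¹ : A) = q ^ (cartanA a b) • e b)
    (hKf : ∀ a b, 1 ≤ a → a ≤ N → 1 ≤ b → b ≤ N →
      (K a : A) * f b * (↑(K a)⁻¹ : A) = q ^ (-(cartanA a b)) • f b)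
    (hef : ∀ a b, 1 ≤ a → a ≤ N → 1 ≤ b → b ≤ N → a ≠ b →
      e a * f b - f b * e a = 0)
    (hefa : ∀ a, 1 ≤ a → a ≤ N →
      e a * f a - f a * e a = (q - q⁻¹)⁻¹ • ((K a : A) - (↑(K a)⁻¹ : A)))
    (hcomm : ∀ a b, 1 ≤ a → a ≤ N → 1 ≤ b → b ≤ N → (a + 2 ≤ b ∨ b + 2 ≤ a) →
      f a * f b = f b * f a)
    (hserre : ∀ a b, 1 ≤ a → a ≤ N → 1 ≤ b → b ≤ N → (b = a + 1 ∨ a = b + 1) →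
      f a ^ 2 * f b - (q + q⁻¹) • (f a * f b * f a) + f b * f a ^ 2 = 0)
    (i j : ℕ) (hi : 1 ≤ i) (hij : i < j) (hj : j ≤ N) :
    (∀ m, i < m → m < j →
      e m * iterQComm q f i j - iterQComm q f i j * e m = 0 ∧
      e m * iterQComm q⁻¹ f i j - iterQComm q⁻¹ f i j * e m = 0) ∧
    (e i * iterQComm q f i j - iterQComm q f i j * e i
      = iterQComm q f (i + 1) j * (↑(K i)⁻¹ : A)) ∧
    (e j * iterQComm q f i j - iterQComm q f i j * e j
      = -(q • (iterQComm q f i (j - 1) * (K j : A)))) ∧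
    (e i * iterQComm q⁻¹ f i j - iterQComm q⁻¹ f i j * e i
      = iterQComm q⁻¹ f (i + 1) j * (K i : A)) ∧
    (e j * iterQComm q⁻¹ f i j - iterQComm q⁻¹ f i j * e j
      = -(q⁻¹ • (iterQComm q⁻¹ f i (j - 1) * (↑(K j)⁻¹ : A)))) := by
  have hKf' : ∀ a b, 1 ≤ a → a ≤ N → 1 ≤ b → b ≤ N →
      (K a : A) * f b = q ^ (-(cartanA a b)) • (f b * (K a : A)) := by
    intro a b h1 h2 h3 h4
    rw [← smul_mul_assoc, ← hKf a b h1 h2 h3 h4, Units.inv_mul_cancel_right]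
  have hLf' : ∀ a b, 1 ≤ a → a ≤ N → 1 ≤ b → b ≤ N →
      (↑(K a)⁻¹ : A) * f b = q ^ (cartanA a b) • (f b * (↑(K a)⁻¹ : A)) := by
    intro a b h1 h2 h3 h4
    have h : f b * (↑(K a)⁻¹ : A) = (↑(K a)⁻¹ : A) * (q ^ (-(cartanA a b)) • f b) := by
      rw [← hKf a b h1 h2 h3 h4, mul_assoc, Units.inv_mul_cancel_left]
    rw [h, mul_smul_comm, smul_smul, ← zpow_add₀ hq0, add_neg_cancel, zpow_zero, one_smul]
  have hef' : ∀ a b, 1 ≤ a → a ≤ N → 1 ≤ b → b ≤ N → a ≠ b →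
      e a * f b = f b * e a := fun a b h1 h2 h3 h4 h5 => sub_eq_zero.1 (hef a b h1 h2 h3 h4 h5)
  obtain ⟨b1, a1, c1⟩ := core q hq0 hq2 N e f (fun a => (K a : A)) (fun a => (↑(K a)⁻¹ : A))
    hKf' hLf' hef' hefa hcomm j hj
  obtain ⟨b2, a2, c2⟩ := core q⁻¹ (inv_ne_zero hq0)
    (by rw [inv_pow]; exact fun h => hq2 (inv_eq_one.1 h)) N e f
    (fun a => (↑(K a)⁻¹ : A)) (fun a => (K a : A))
    (by simpa [inv_zpow'] using hLf') (by simpa only [inv_zpow'] using hKf') hef'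
    (fun a h1 h2 => by
      rw [hefa a h1 h2, inv_inv, ← neg_sub q q⁻¹, inv_neg, neg_smul, ← smul_neg, neg_sub])
    hcomm j hj
  exact ⟨fun m h1 h2 => ⟨a1 i m hi h1 h2, a2 i m hi h1 h2⟩, b1 i hi hij, c1 i hi hij,
    b2 i hi hij, c2 i hi hij⟩
end

section
/- Let k be a field and q ∈ k a nonzero scalar with q⁴ ≠ 1, and let p ≥ 1. Let A be an associative k-algebra containing elements e_1,…,e_p, e_β, f_1,…,f_p, f_β and invertible elements K_1,…,K_p, K_β satisfying the defining relations of U_q(sp(2p+2)) with short simple roots α_1,…,α_p and long simple root β adjacent to α_p: the K's commute pairwise; K_a e_b K_a⁻¹ = q^{(α_a,α_b)} e_b and K_a f_b K_a⁻¹ = q^{−(α_a,α_b)} f_b for all a,b ∈ {1,…,p,β}, where (α_a,α_a) = 2 for a ≤ p, (β,β) = 4, (α_a,α_b) = −1 for |a−b| = 1 with a,b ≤ p, (β,α_p) = −2, and all other pairings are 0; e_a f_b − f_b e_a = 0 for a ≠ b, e_a f_a − f_a e_a = (K_a − K_a⁻¹)/(q − q⁻¹) for a ≤ p, and e_β f_β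 − f_β e_β = (K_β − K_β⁻¹)/(q² − q⁻²); and both the e's and the f's satisfy the q-Serre relations of U_q(sp(2p+2)) (for the f's: f_a f_b = f_b f_a for |a−b| ≥ 2; f_β f_a = f_a f_β for a ≤ p−1; f_a² f_b − (q+q⁻¹) f_a f_b f_a + f_b f_a² = 0 for |a−b| = 1, a,b ≤ p; f_β² f_p − (q²+q⁻²) f_β f_p f_β + f_p f_β² = 0; f_p³ f_β − (q²+1+q⁻²) f_p² f_β f_p + (q²+1+q⁻²) f_p f_β f_p² − f_β f_p³ = 0; and the same relations with e in place of f). Let M be a left A-module and v ∈ M a vector such that e_a v = 0 for all a ∈ {1,…,p,β}; f_a v = 0 for a = 2,…,p and f_β v = 0; K_a v = v for a = 2,…,p and K_β v = v; and K_1 v = c·v for an invertible scalar c ∈ k with c² = −q^{−2p}. Set f_γ := [f_1,[f_2,…,[f_{p−1},f_p]_q…]_q]_q, f̃_γ := [f_1,[f_2,…,[f_{p−1},f_p]_{q⁻¹}…]_{q⁻¹}]_{q⁻¹}, and f_δ := [f_γ, [f̃_γ, f_β]_{q⁻²}]_{q²}. Then f_δ·v is a singular vector: e_a·(f_δ·v)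 = 0 for all a ∈ {1,…,p,β}. -/
/-- The symmetrized Cartan pairing `(α_a, α_b)` of `sp(2p+2)`, where the simple roots
are indexed by `1,…,p` (short) and `p+1` (the long root `β`, adjacent to `α_p`). -/
def spPairing (p a b : ℕ) : ℤ :=
  if a = b then (if a = p + 1 then 4 else 2)
  else if (a + 1 = b ∨ b + 1 = a) ∧ a ≤ p ∧ b ≤ p then -1
  else if (a = p ∧ b = p + 1) ∨ (a = p + 1 ∧ b = p) then -2
  else 0

section Helpers

theorem iterQComm_self {k A : Type*} [CommRing k] [Ring A] [Algebra k A]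
    (t : k) (f : ℕ → A) (j : ℕ) : iterQComm t f j j = f j := by
  simp [iterQComm]

theorem iterQComm_step {k A : Type*} [CommRing k] [Ring A] [Algebra k A]
    (t : k) (f : ℕ → A) (i j : ℕ) (h : i < j) :
    iterQComm t f i j = f i * iterQComm t f (i+1) j - t • (iterQComm t f (i+1) j * f i) := by
  unfold iterQComm
  obtain ⟨d, rfl⟩ : ∃ d, j = i + d + 1 := ⟨j - i - 1, by omega⟩
  have h1 : i + d + 1 - i = d + 1 := by omega
  have h2 : i + d + 1 - (i + 1) = d := by omega
  rw [h1, h2, List.range'_succ, List.foldr_cons, qComm]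

/-- downward induction -/
theorem down_ind {P : ℕ → Prop} (j : ℕ) (h0 : P j) (hs : ∀ i, i < j → P (i+1) → P i) :
    ∀ i, i ≤ j → P i := by
  intro i hi
  obtain ⟨d, rfl⟩ := Nat.exists_eq_add_of_le hi
  clear hi
  induction d generalizing i with
  | zero => exact h0
  | succ d ih =>
    apply hs i (by omega)
    apply ih (i+1)
    · convert h0 using 1; omega
    · intro i' hi'; exact hs i' (by omega)

theorem iter_comm {k A : Type*} [CommRing k] [Ring A] [Algebra k A]
    (t : k) (f : ℕ → A) (g : A) (j i : ℕ) (hij : i ≤ j)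
    (hg : ∀ a, i ≤ a → a ≤ j → g * f a = f a * g) :
    g * iterQComm t f i j = iterQComm t f i j * g := by
  revert hg
  refine down_ind (P := fun i => (∀ a, i ≤ a → a ≤ j → g * f a = f a * g) →
    g * iterQComm t f i j = iterQComm t f i j * g) j ?_ ?_ i hij
  · intro h; rw [iterQComm_self]; exact h j le_rfl le_rfl
  · intro i hi ih h
    have h1 := ih (fun a ha => h a (by omega))
    have h2 := h i le_rfl hi.le
    rw [iterQComm_step t f i j hi]
    generalize iterQComm t f (i+1) j = F at *
    simp only [mul_sub, sub_mul, mul_smul_comm, smul_mul_assoc]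
    rw [← mul_assoc, h2, mul_assoc, h1, ← mul_assoc, ← mul_assoc, h1, mul_assoc F, h2, ← mul_assoc]

theorem iter_kill {k A M : Type*} [CommRing k] [Ring A] [Algebra k A]
    [AddCommGroup M] [Module A M] [Module k M] [IsScalarTower k A M]
    (t : k) (f : ℕ → A) (u : M) (j i : ℕ) (hij : i ≤ j)
    (hg : ∀ a, i ≤ a → a ≤ j → f a • u = 0) :
    iterQComm t f i j • u = 0 := by
  revert hg
  refine down_ind (P := fun i => (∀ a, i ≤ a → a ≤ j → f a • u = 0) →
    iterQComm t f i j • u = 0) j ?_ ?_ i hij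
  · intro h; rw [iterQComm_self]; exact h j le_rfl le_rfl
  · intro i hi ih h
    have h1 := ih (fun a ha => h a (by omega))
    have h2 := h i le_rfl hi.le
    rw [iterQComm_step t f i j hi]
    simp [sub_smul, mul_smul, h1, h2]

/-- right associativity -/
theorem iter_assoc {k A : Type*} [CommRing k] [Ring A] [Algebra k A]
    (t : k) (f : ℕ → A) (j i : ℕ) (hij : i ≤ j)
    (hg : ∀ a, i ≤ a → a < j → f a * f (j+1) = f (j+1) * f a) :
    iterQComm t f i (j+1) = iterQComm t f i j * f (j+1) - t • (f (j+1) * iterQComm t f i j) := by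
  revert hg
  refine down_ind (P := fun i => (∀ a, i ≤ a → a < j → f a * f (j+1) = f (j+1) * f a) →
    iterQComm t f i (j+1) = iterQComm t f i j * f (j+1) - t • (f (j+1) * iterQComm t f i j)) j ?_ ?_ i hij
  · intro h; rw [iterQComm_step _ _ _ _ (Nat.lt_succ_self j), iterQComm_self, iterQComm_self]
  · intro i hi ih h
    have h1 := ih (fun a ha => h a (by omega))
    have h2 := h i le_rfl hi
    rw [iterQComm_step t f i j hi, iterQComm_step t f i (j+1) (by omega), h1]
    generalize iterQComm t f (i+1) j = F at *
    simp only [mul_sub, sub_mul, mul_smul_comm, smul_mul_assoc, mul_assoc, smul_sub]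
    rw [← h2, ← mul_assoc (f i) (f (j+1)), h2, mul_assoc]
    abel

/-- `f j * ... * f 1` -/
def TT {A : Type*} [Ring A] (f : ℕ → A) : ℕ → A
  | 0 => 1
  | j+1 => f (j+1) * TT f j

theorem TT_comm {A : Type*} [Ring A] (f : ℕ → A) (g : A) (j : ℕ)
    (h : ∀ a, 1 ≤ a → a ≤ j → g * f a = f a * g) : g * TT f j = TT f j * g := by
  induction j with
  | zero => simp [TT]
  | succ j ih =>
    rw [TT, ← mul_assoc, h _ (by omega) le_rfl, mul_assoc, ih (fun a h1 h2 => h a h1 (by omega)), mul_assoc]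

theorem iter_TT {k A M : Type*} [CommRing k] [Ring A] [Algebra k A]
    [AddCommGroup M] [Module A M] [Module k M] [IsScalarTower k A M]
    (t : k) (f : ℕ → A) (j : ℕ) (hj : 1 ≤ j)
    (hcomm : ∀ a b, 1 ≤ a → a + 2 ≤ b → b ≤ j → f a * f b = f b * f a)
    (u : M) (hu : ∀ a, 2 ≤ a → a ≤ j → f a • u = 0) :
    iterQComm t f 1 j • u = (-t)^(j-1) • TT f j • u := by
  have key := down_ind (P := fun i => 1 ≤ i → iterQComm t f i j • TT f (i-1) • u = (-t)^(j-i) • TT f j • u)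
    j ?_ ?_ 1 hj le_rfl
  · simpa [TT] using key
  · intro hj
    obtain ⟨j, rfl⟩ := Nat.exists_eq_add_of_le' hj
    simp [iterQComm_self, TT, mul_smul]
  · intro i hi ih h1
    obtain ⟨i, rfl⟩ := Nat.exists_eq_add_of_le' h1
    have ih := ih (by omega)
    have hc : iterQComm t f (i+1+1) j * TT f i = TT f i * iterQComm t f (i+1+1) j := by
      apply TT_comm
      intro a ha hai
      symm
      apply iter_comm t f _ j _ (by omega)
      intro b hb hbj
      exact hcomm a b ha (by omega) hbj
    have hk := iter_kill t f u j (i+1+1) (by omega) (fun a ha => hu a (by omega))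
    rw [iterQComm_step t f _ j hi]
    simp only [Nat.add_sub_cancel] at ih ⊢
    rw [sub_smul, mul_smul, ← mul_smul _ (TT f i), hc, smul_assoc, mul_smul, mul_smul, hk]
    rw [TT, mul_smul] at ih
    rw [ih]
    have : j - (i+1) = (j - (i+1+1)) + 1 := by omega
    rw [this, pow_succ]
    simp [smul_smul, mul_comm]

theorem kill_TT {k A M : Type*} [Field k] [Ring A] [Algebra k A]
    [AddCommGroup M] [Module A M] [Module k M] [IsScalarTower k A M]
    (s : k) (hs : s ≠ 0) (f : ℕ → A) (p : ℕ)
    (hcomm : ∀ a b, 1 ≤ a → a ≤ p → 1 ≤ b → b ≤ p → (a + 2 ≤ b ∨ b + 2 ≤ a) → f a * f b = f b * f a)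
    (hserre : ∀ a b, 1 ≤ a → a ≤ p → 1 ≤ b → b ≤ p → (b = a + 1 ∨ a = b + 1) →
      f a ^ 2 * f b - s • (f a * f b * f a) + f b * f a ^ 2 = 0)
    (u : M) (hu : ∀ a, 2 ≤ a → a ≤ p → f a • u = 0) :
    ∀ j, j ≤ p → ∀ a, 2 ≤ a → a ≤ j → f a • TT f j • u = 0 := by
  have hfar : ∀ j a, j + 2 ≤ a → a ≤ p → f a • TT f j • u = 0 := by
    intro j a h1 h2
    rw [← mul_smul, TT_comm f (f a) j, mul_smul, hu a (by omega) h2, smul_zero]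
    intro b hb hb2
    exact hcomm a b (by omega) h2 hb (by omega) (by omega)
  have hdiag : ∀ j, 2 ≤ j → j ≤ p → f j • TT f j • u = 0 := by
    intro j h1 h2
    obtain ⟨j, rfl⟩ := Nat.exists_eq_add_of_le' h1
    have h := congrArg (fun x => x • TT f j • u) (hserre (j+2) (j+1) (by omega) h2 (by omega) (by omega) (by omega))
    have h3 := hfar j (j+2) le_rfl h2
    simp only [add_smul, sub_smul, mul_smul, smul_assoc, pow_two, h3, smul_zero, zero_smul, sub_zero, add_zero] at h
    simpa [TT, mul_smul] using h
  intro j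
  induction j with
  | zero => intro _ a h1 h2; omega
  | succ j ih =>
    intro hj a h2 ha
    rcases Nat.lt_trichotomy a j with hlt | rfl | hgt
    · rw [TT, ← mul_smul, ← mul_assoc, hcomm a (j+1) (by omega) (by omega) (by omega) hj (by omega), mul_assoc,
        mul_smul, mul_smul, ih (by omega) a h2 hlt.le, smul_zero]
    · obtain ⟨a, rfl⟩ := Nat.exists_eq_add_of_le' h2
      have h := congrArg (fun x => x • TT f (a+1) • u) (hserre (a+2) (a+3) (by omega) (by omega) (by omega) (by omega) (by omega))
      have h3 := hfar (a+1) (a+3) le_rfl hj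
      have h4 := ih (by omega) (a+2) h2 le_rfl
      simp only [TT, mul_smul] at h4 h h3 ⊢
      simp only [add_smul, sub_smul, mul_smul, smul_assoc, pow_two, h3, h4, smul_zero, zero_smul, zero_sub, add_zero] at h
      rw [neg_eq_zero, smul_eq_zero_iff_right hs] at h
      exact h
    · have : a = j+1 := by omega
      subst this
      exact hdiag _ h2 hj

theorem serre_TT {k A M : Type*} [Field k] [Ring A] [Algebra k A]
    [AddCommGroup M] [Module A M] [Module k M] [IsScalarTower k A M]
    (s : k) (hs : s ≠ 0) (f : ℕ → A) (p : ℕ)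
    (hcomm : ∀ a b, 1 ≤ a → a ≤ p → 1 ≤ b → b ≤ p → (a + 2 ≤ b ∨ b + 2 ≤ a) → f a * f b = f b * f a)
    (hserre : ∀ a b, 1 ≤ a → a ≤ p → 1 ≤ b → b ≤ p → (b = a + 1 ∨ a = b + 1) →
      f a ^ 2 * f b - s • (f a * f b * f a) + f b * f a ^ 2 = 0)
    (u : M) (hu : ∀ a, 2 ≤ a → a ≤ p → f a • u = 0) :
    ∀ j, j + 2 ≤ p → f (j+2) • TT f (j+1) • TT f (j+1) • u = s • TT f (j+1) • f (j+2) • TT f (j+1) • u := by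
  intro j
  induction j with
  | zero =>
    intro hp
    have h := congrArg (fun x => x • u) (hserre 1 2 le_rfl (by omega) (by omega) (by omega) (by omega))
    have h3 := hu 2 le_rfl hp
    simp only [add_smul, sub_smul, mul_smul, smul_assoc, pow_two, h3, smul_zero, zero_smul] at h
    simp only [TT, mul_one, zero_add]
    rw [← sub_eq_zero, ← h]; abel
  | succ j ih =>
    intro hp
    have ih := ih (by omega)
    have hc : f (j+3) * TT f (j+1) = TT f (j+1) * f (j+3) := by
      apply TT_comm
      intro b hb hb2
      exact hcomm _ b (by omega) hp hb (by omega) (by omega)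
    have hcs : ∀ m : M, f (j+3) • TT f (j+1) • m = TT f (j+1) • f (j+3) • m := by
      intro m; rw [← mul_smul, hc, mul_smul]
    have h := congrArg (fun x => x • TT f (j+1) • TT f (j+1) • u)
      (hserre (j+2) (j+3) (by omega) (by omega) (by omega) (by omega) (by omega))
    have h3 := hu (j+3) (by omega) hp
    simp only [add_smul, sub_smul, mul_smul, smul_assoc, pow_two, hcs, h3, smul_zero, zero_smul, zero_sub] at h
    rw [ih] at h
    rw [show TT f (j+1+1) = f (j+2) * TT f (j+1) from rfl]
    simp only [mul_smul]
    rw [show j+1+2 = j+3 from rfl]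
    rw [← sub_eq_zero, ← smul_eq_zero_iff_right hs, ← h]
    simp only [smul_sub, smul_comm (_ : A) s, hcs]
    abel

end Helpers
section Helpers2

theorem eF_same {k A : Type*} [Field k] [Ring A] [Algebra k A]
    (t : k) (ht : t - t⁻¹ ≠ 0) (e x Y K L : A)
    (h : e * x - x * e = (t - t⁻¹)⁻¹ • (K - L)) (hY : e * Y = Y * e)
    (hK : K * Y = t • (Y * K)) (hL : L * Y = t⁻¹ • (Y * L)) :
    e * (x * Y - t • (Y * x)) = (x * Y - t • (Y * x)) * e + Y * L := by
  have h' : e * x = x * e + (t - t⁻¹)⁻¹ • (K - L) := by rw [← h]; abel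
  have h1 : e * (x * Y) = x * Y * e + (t - t⁻¹)⁻¹ • (t • (Y * K) - t⁻¹ • (Y * L)) := by
    rw [← mul_assoc, h', add_mul, mul_assoc, hY, smul_mul_assoc, sub_mul, hK, hL, mul_assoc]
  have h2 : e * (Y * x) = Y * x * e + (t - t⁻¹)⁻¹ • (Y * K - Y * L) := by
    rw [← mul_assoc, hY, mul_assoc, h', mul_add, mul_smul_comm, mul_sub, mul_assoc]
  rw [mul_sub, mul_smul_comm, h1, h2, sub_mul, smul_mul_assoc]
  have h3 : Y * L = ((t - t⁻¹)⁻¹ * (t - t⁻¹)) • (Y * L) := by rw [inv_mul_cancel₀ ht, one_smul]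
  conv_rhs => rw [h3]
  module

section
variable {k A : Type*} [Field k] [Ring A] [Algebra k A]
    (t : k) (ht0 : t ≠ 0) (ht : t - t⁻¹ ≠ 0) (f : ℕ → A) (p a : ℕ) (e K L : A)
    (hef : ∀ b, 1 ≤ b → b ≤ p → b ≠ a → e * f b = f b * e)
    (hcom : e * f a - f a * e = (t - t⁻¹)⁻¹ • (K - L))
    (hK1 : ∀ b, (b = a + 1 ∨ b + 1 = a) → 1 ≤ b → b ≤ p → K * f b = t • (f b * K))
    (hL1 : ∀ b, (b = a + 1 ∨ b + 1 = a) → 1 ≤ b → b ≤ p → L * f b = t⁻¹ • (f b * L))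
    (hK0 : ∀ b, (a + 2 ≤ b ∨ b + 2 ≤ a) → 1 ≤ b → b ≤ p → K * f b = f b * K)
    (hL0 : ∀ b, (a + 2 ≤ b ∨ b + 2 ≤ a) → 1 ≤ b → b ≤ p → L * f b = f b * L)
    (hcomm : ∀ a b, 1 ≤ a → a ≤ p → 1 ≤ b → b ≤ p → (a + 2 ≤ b ∨ b + 2 ≤ a) → f a * f b = f b * f a)

theorem scal_iter (s : k) (G : A) (i : ℕ) (hi : i ≤ p)
    (h1 : G * f i = s • (f i * G))
    (h0 : ∀ b, i + 1 ≤ b → b ≤ p → G * f b = f b * G) :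
    G * iterQComm t f i p = s • (iterQComm t f i p * G) := by
  rcases hi.eq_or_lt with rfl | hlt
  · rw [iterQComm_self, h1]
  · have hc := iter_comm t f G p (i+1) hlt h0
    rw [iterQComm_step t f i p hlt]
    generalize iterQComm t f (i+1) p = F at *
    have e1 : G * (f i * F) = s • (f i * F * G) := by
      rw [← mul_assoc, h1, smul_mul_assoc, mul_assoc, hc, mul_assoc]
    have e2 : G * (F * f i) = s • (F * f i * G) := by
      rw [← mul_assoc, hc, mul_assoc, h1, mul_smul_comm, mul_assoc]
    rw [mul_sub, mul_smul_comm, e1, e2, sub_mul, smul_mul_assoc]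
    module

include ht hef hcom hK1 hL1 hK0 hL0 in
theorem eF_first (ha : 1 ≤ a) (hap : a < p) :
    e * iterQComm t f a p = iterQComm t f a p * e + iterQComm t f (a+1) p * L := by
  rw [iterQComm_step t f a p hap]
  apply eF_same t ht e (f a) _ K L hcom
  · exact iter_comm t f e p (a+1) hap (fun b hb hbp => hef b (by omega) hbp (by omega))
  · exact scal_iter t f p t K (a+1) hap (hK1 _ (Or.inl rfl) (by omega) hap)
      (fun b hb hbp => hK0 b (by omega) (by omega) hbp)
  · exact scal_iter t f p t⁻¹ L (a+1) hap (hL1 _ (Or.inl rfl) (by omega) hap)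
      (fun b hb hbp => hL0 b (by omega) (by omega) hbp)

include ht0 ht hef hcom hK1 hL1 hK0 hL0 hcomm in
theorem eF_mid (hap : a < p) : ∀ i, i + 1 ≤ a → 1 ≤ i →
    e * iterQComm t f i p = iterQComm t f i p * e := by
  intro i hi
  obtain ⟨a, rfl⟩ : ∃ b, a = b + 1 := ⟨a - 1, by omega⟩
  refine down_ind (P := fun i => 1 ≤ i → e * iterQComm t f i p = iterQComm t f i p * e) a ?_ ?_ i (by omega)
  · intro ha
    have h1 := eF_first t ht f p (a+1) e K L hef hcom hK1 hL1 hK0 hL0 (by omega) hap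
    have h2 : f a * iterQComm t f (a+1+1) p = iterQComm t f (a+1+1) p * f a :=
      iter_comm t f _ p _ hap (fun b hb hbp => hcomm a b ha (by omega) (by omega) hbp (by omega))
    have h3 := hL1 a (Or.inr rfl) ha (by omega)
    have h4 := hef a ha (by omega) (by omega)
    rw [iterQComm_step t f a p (by omega)]
    generalize iterQComm t f (a+1) p = F at *
    generalize iterQComm t f (a+1+1) p = F' at *
    have e1 : e * (f a * F) = f a * F * e + F' * f a * L := by
      rw [← mul_assoc, h4, mul_assoc, h1, mul_add, ← mul_assoc, ← mul_assoc, h2]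
    have e2 : e * (F * f a) = F * f a * e + t⁻¹ • (F' * f a * L) := by
      rw [← mul_assoc, h1, add_mul, mul_assoc, h4, mul_assoc F', h3, mul_smul_comm, mul_assoc, mul_assoc]
    rw [mul_sub, mul_smul_comm, e1, e2, sub_mul, smul_mul_assoc, smul_add, smul_smul, mul_inv_cancel₀ ht0]
    module
  · intro i hi ih h1
    have ih := ih (by omega)
    have h4 := hef i h1 (by omega) (by omega)
    rw [iterQComm_step t f i p (by omega)]
    generalize iterQComm t f (i+1) p = F at *
    rw [mul_sub, mul_smul_comm, sub_mul, smul_mul_assoc, ← mul_assoc, h4, mul_assoc, ih, ← mul_assoc e, ih,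
      mul_assoc F e, h4]
    simp only [mul_assoc]

end

theorem eF_last {k A : Type*} [Field k] [Ring A] [Algebra k A]
    (t : k) (ht0 : t ≠ 0) (ht : t - t⁻¹ ≠ 0) (f : ℕ → A) (p : ℕ) (e K L : A)
    (hef : ∀ b, 1 ≤ b → b ≤ p → e * f b = f b * e)
    (hcom : e * f (p+1) - f (p+1) * e = (t - t⁻¹)⁻¹ • (K - L))
    (hK1 : 1 ≤ p → K * f p = t • (f p * K))
    (hL1 : 1 ≤ p → L * f p = t⁻¹ • (f p * L))
    (hK0 : ∀ b, b + 1 ≤ p → 1 ≤ b → K * f b = f b * K) : ∀ i, i ≤ p → 1 ≤ i →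
    e * iterQComm t f i (p+1) = iterQComm t f i (p+1) * e - K * iterQComm t f i p := by
  intro i hi
  refine down_ind (P := fun i => 1 ≤ i →
    e * iterQComm t f i (p+1) = iterQComm t f i (p+1) * e - K * iterQComm t f i p) p ?_ ?_ i (by omega)
  · intro h1
    have hK := hK1 h1
    have hL := hL1 h1
    have he := hef p h1 le_rfl
    rw [iterQComm_step _ _ _ _ (Nat.lt_succ_self p), iterQComm_self, iterQComm_self]
    generalize f p = x at *
    generalize f (p+1) = y at *
    have hcom' : e * y = y * e + (t - t⁻¹)⁻¹ • (K - L) := by rw [← hcom]; abel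
    have hKi : x * K = t⁻¹ • (K * x) := by rw [hK, smul_smul, inv_mul_cancel₀ ht0, one_smul]
    have hLi : x * L = t • (L * x) := by rw [hL, smul_smul, mul_inv_cancel₀ ht0, one_smul]
    have e1 : e * (x * y) = x * y * e + (t - t⁻¹)⁻¹ • (t⁻¹ • (K * x) - t • (L * x)) := by
      rw [← mul_assoc, he, mul_assoc, hcom', mul_add, mul_smul_comm, mul_sub, hKi, hLi, mul_assoc]
    have e2 : e * (y * x) = y * x * e + (t - t⁻¹)⁻¹ • (K * x - L * x) := by
      rw [← mul_assoc, hcom', add_mul, mul_assoc, he, smul_mul_assoc, sub_mul, mul_assoc]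
    have h3 : K * x = ((t - t⁻¹)⁻¹ * (t - t⁻¹)) • (K * x) := by rw [inv_mul_cancel₀ ht, one_smul]
    rw [mul_sub, mul_smul_comm, sub_mul, smul_mul_assoc, e1, e2]
    conv_rhs => rw [h3]
    module
  · intro i hi ih h1
    have ih := ih (by omega)
    have h4 := hef i h1 (by omega)
    have hK := hK0 i (by omega) h1
    rw [iterQComm_step t f i (p+1) (by omega), iterQComm_step t f i p (by omega)]
    generalize iterQComm t f (i+1) (p+1) = F at *
    generalize iterQComm t f (i+1) p = F' at *
    have e1 : e * (f i * F) = f i * F * e - K * (f i * F') := by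
      rw [← mul_assoc, h4, mul_assoc, ih, mul_sub, ← mul_assoc, ← mul_assoc, ← hK, mul_assoc K]
    have e2 : e * (F * f i) = F * f i * e - K * (F' * f i) := by
      rw [← mul_assoc, ih, sub_mul, mul_assoc, h4, mul_assoc, mul_assoc]
    rw [mul_sub, mul_smul_comm, sub_mul, smul_mul_assoc, e1, e2, mul_sub, mul_smul_comm]
    module

/-- `iter` on vectors killed by all but the last `f`. -/
theorem iter_indep {k A M : Type*} [CommRing k] [Ring A] [Algebra k A]
    [AddCommGroup M] [Module A M] [Module k M] [IsScalarTower k A M]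
    (t s : k) (f : ℕ → A) (u : M) (j i : ℕ) (hij : i ≤ j)
    (hg : ∀ a, i ≤ a → a < j → f a • u = 0) :
    iterQComm t f i j • u = iterQComm s f i j • u := by
  revert hg
  refine down_ind (P := fun i => (∀ a, i ≤ a → a < j → f a • u = 0) →
    iterQComm t f i j • u = iterQComm s f i j • u) j ?_ ?_ i hij
  · intro h; rw [iterQComm_self, iterQComm_self]
  · intro i hi ih h
    have h1 := ih (fun a ha => h a (by omega))
    have h2 := h i le_rfl hi
    rw [iterQComm_step t f i j hi, iterQComm_step s f i j hi]
    simp [sub_smul, mul_smul, h1, h2]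

theorem unit_inv_smul {k A M : Type*} [Field k] [Ring A] [Algebra k A]
    [AddCommGroup M] [Module A M] [Module k M] [IsScalarTower k A M]
    (K : Aˣ) (s : k) (hs : s ≠ 0) (u : M) (h : (K : A) • u = s • u) :
    (↑K⁻¹ : A) • u = s⁻¹ • u := by
  have h2 : (↑K⁻¹ : A) • (K : A) • u = u := by rw [← mul_smul, Units.inv_mul, one_smul]
  rw [h, smul_comm] at h2
  conv_rhs => rw [← h2, smul_smul, inv_mul_cancel₀ hs, one_smul]

theorem conj_swap {k A : Type*} [Field k] [Ring A] [Algebra k A]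
    (K : Aˣ) (s : k) (x : A) (h : (K : A) * x * (↑K⁻¹ : A) = s • x) :
    (K : A) * x = s • (x * K) := by
  have := congrArg (fun y => y * (K : A)) h
  simpa [mul_assoc] using this

theorem conj_swap_inv {k A : Type*} [Field k] [Ring A] [Algebra k A]
    (K : Aˣ) (s : k) (hs : s ≠ 0) (x : A) (h : (K : A) * x * (↑K⁻¹ : A) = s • x) :
    (↑K⁻¹ : A) * x = s⁻¹ • (x * (↑K⁻¹ : A)) := by
  have := congrArg (fun y => s⁻¹ • ((↑K⁻¹ : A) * y)) h
  simp only [mul_smul_comm, smul_smul, inv_mul_cancel₀ hs, one_smul] at this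
  rw [← this]
  simp [← mul_assoc]

end Helpers2
/-- in `U_q(sp(2p+2))`, if `v` is a highest weight vector killed by
`f_2,…,f_p,f_β`, fixed by `K_2,…,K_p,K_β`, with `K_1 v = c v` and `c² = −q^{−2p}`, then
`f_δ·v` is a singular vector, i.e. it is killed by all positive Chevalley generators.
(Indices `1,…,p` are the short roots and `p+1` stands for the long root `β`.) -/
theorem f_delta_v_is_singular
    {k A M : Type*} [Field k] [Ring A] [Algebra k A]
    [AddCommGroup M] [Module A M] [Module k M] [IsScalarTower k A M]
    (q : k) (hq0 : q ≠ 0) (hq4 : q ^ 4 ≠ 1)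
    (p : ℕ) (hp : 1 ≤ p) (e f : ℕ → A) (K : ℕ → Aˣ)
    (hKcomm : ∀ a b, (K a : A) * (K b : A) = (K b : A) * (K a : A))
    (hKe : ∀ a b, 1 ≤ a → a ≤ p + 1 → 1 ≤ b → b ≤ p + 1 →
      (K a : A) * e b * (↑(K a)⁻¹ : A) = q ^ (spPairing p a b) • e b)
    (hKf : ∀ a b, 1 ≤ a → a ≤ p + 1 → 1 ≤ b → b ≤ p + 1 →
      (K a : A) * f b * (↑(K a)⁻¹ : A) = q ^ (-(spPairing p a b)) • f b)
    (hef : ∀ a b, 1 ≤ a → a ≤ p + 1 → 1 ≤ b → b ≤ p + 1 → a ≠ b →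
      e a * f b - f b * e a = 0)
    (hefShort : ∀ a, 1 ≤ a → a ≤ p →
      e a * f a - f a * e a = (q - q⁻¹)⁻¹ • ((K a : A) - (↑(K a)⁻¹ : A)))
    (hefLong : e (p + 1) * f (p + 1) - f (p + 1) * e (p + 1)
      = (q ^ 2 - (q ^ 2)⁻¹)⁻¹ • ((K (p + 1) : A) - (↑(K (p + 1))⁻¹ : A)))
    (hfcomm : ∀ a b, 1 ≤ a → a ≤ p → 1 ≤ b → b ≤ p → (a + 2 ≤ b ∨ b + 2 ≤ a) →
      f a * f b = f b * f a)
    (hfβcomm : ∀ a, 1 ≤ a → a + 1 ≤ p → f (p + 1) * f a = f a * f (p + 1))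
    (hfserre : ∀ a b, 1 ≤ a → a ≤ p → 1 ≤ b → b ≤ p → (b = a + 1 ∨ a = b + 1) →
      f a ^ 2 * f b - (q + q⁻¹) • (f a * f b * f a) + f b * f a ^ 2 = 0)
    (hfββ : f (p + 1) ^ 2 * f p - (q ^ 2 + (q ^ 2)⁻¹) • (f (p + 1) * f p * f (p + 1))
      + f p * f (p + 1) ^ 2 = 0)
    (hfppβ : f p ^ 3 * f (p + 1) - (q ^ 2 + 1 + (q ^ 2)⁻¹) • (f p ^ 2 * f (p + 1) * f p)
      + (q ^ 2 + 1 + (q ^ 2)⁻¹) • (f p * f (p + 1) * f p ^ 2) - f (p + 1) * f p ^ 3 = 0)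
    (hecomm : ∀ a b, 1 ≤ a → a ≤ p → 1 ≤ b → b ≤ p → (a + 2 ≤ b ∨ b + 2 ≤ a) →
      e a * e b = e b * e a)
    (heβcomm : ∀ a, 1 ≤ a → a + 1 ≤ p → e (p + 1) * e a = e a * e (p + 1))
    (heserre : ∀ a b, 1 ≤ a → a ≤ p → 1 ≤ b → b ≤ p → (b = a + 1 ∨ a = b + 1) →
      e a ^ 2 * e b - (q + q⁻¹) • (e a * e b * e a) + e b * e a ^ 2 = 0)
    (heββ : e (p + 1) ^ 2 * e p - (q ^ 2 + (q ^ 2)⁻¹) • (e (p + 1) * e p * e (p + 1))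
      + e p * e (p + 1) ^ 2 = 0)
    (heppβ : e p ^ 3 * e (p + 1) - (q ^ 2 + 1 + (q ^ 2)⁻¹) • (e p ^ 2 * e (p + 1) * e p)
      + (q ^ 2 + 1 + (q ^ 2)⁻¹) • (e p * e (p + 1) * e p ^ 2) - e (p + 1) * e p ^ 3 = 0)
    (v : M)
    (hev : ∀ a, 1 ≤ a → a ≤ p + 1 → e a • v = 0)
    (hfv : ∀ a, 2 ≤ a → a ≤ p + 1 → f a • v = 0)
    (hKv : ∀ a, 2 ≤ a → a ≤ p + 1 → (K a : A) • v = v)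
    (c : k) (hc : c ≠ 0) (hc2 : c ^ 2 = -(q ^ (2 * p))⁻¹)
    (hK1v : (K 1 : A) • v = c • v) :
    ∀ a, 1 ≤ a → a ≤ p + 1 →
      e a • ((qComm (q ^ 2) (iterQComm q f 1 p)
        (qComm ((q ^ 2)⁻¹) (iterQComm q⁻¹ f 1 p) (f (p + 1)))) • v) = 0 := by
  have hq1 : q - q⁻¹ ≠ 0 := by
    intro h
    apply hq4
    field_simp at h
    linear_combination (q^2 + 1) * h
  have hqi1 : q⁻¹ - q⁻¹⁻¹ ≠ 0 := by
    intro h; apply hq1; rw [inv_inv] at h; linear_combination -h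
  have hqs : q + q⁻¹ ≠ 0 := by
    intro h
    apply hq4
    field_simp at h
    linear_combination (q^2 - 1) * h
  have hq2 : q ^ 2 - (q ^ 2)⁻¹ ≠ 0 := by
    intro h
    apply hq4
    field_simp at h
    linear_combination h
  have hqi0 : q⁻¹ ≠ 0 := inv_ne_zero hq0
  -- pairings
  have pfar : ∀ a b, 1 ≤ a → a ≤ p → 1 ≤ b → b ≤ p → (a + 2 ≤ b ∨ b + 2 ≤ a) → spPairing p a b = 0 := by
    intro a b _ _ _ _ _
    unfold spPairing
    split_ifs <;> first | rfl | omega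
  have padj : ∀ a b, 1 ≤ a → a ≤ p → 1 ≤ b → b ≤ p → (b = a + 1 ∨ b + 1 = a) → spPairing p a b = -1 := by
    intro a b _ _ _ _ _
    unfold spPairing
    split_ifs <;> first | rfl | omega
  have pself : ∀ a, 1 ≤ a → a ≤ p → spPairing p a a = 2 := by
    intro a _ _
    unfold spPairing
    split_ifs <;> first | rfl | omega
  have pβp : spPairing p (p+1) p = -2 := by
    unfold spPairing
    split_ifs <;> first | rfl | omega
  have ppβ : spPairing p p (p+1) = -2 := by
    unfold spPairing
    split_ifs <;> first | rfl | omega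
  have pβ0 : ∀ a, 1 ≤ a → a < p → spPairing p (p+1) a = 0 := by
    intro a _ _
    unfold spPairing
    split_ifs <;> first | rfl | omega
  have p0β : ∀ a, 1 ≤ a → a < p → spPairing p a (p+1) = 0 := by
    intro a _ _
    unfold spPairing
    split_ifs <;> first | rfl | omega
  -- weights
  have hKfar : ∀ a b, 1 ≤ a → a ≤ p → 1 ≤ b → b ≤ p → (a + 2 ≤ b ∨ b + 2 ≤ a) →
      (K a : A) * f b = f b * K a := by
    intro a b h1 h2 h3 h4 h5
    simpa [pfar a b h1 h2 h3 h4 h5] using conj_swap _ _ _ (hKf a b h1 (by omega) h3 (by omega))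
  have hLfar : ∀ a b, 1 ≤ a → a ≤ p → 1 ≤ b → b ≤ p → (a + 2 ≤ b ∨ b + 2 ≤ a) →
      (↑(K a)⁻¹ : A) * f b = f b * (↑(K a)⁻¹ : A) := by
    intro a b h1 h2 h3 h4 h5
    simpa [pfar a b h1 h2 h3 h4 h5] using
      conj_swap_inv _ _ (zpow_ne_zero _ hq0) _ (hKf a b h1 (by omega) h3 (by omega))
  have hKadj : ∀ a b, 1 ≤ a → a ≤ p → 1 ≤ b → b ≤ p → (b = a + 1 ∨ b + 1 = a) →
      (K a : A) * f b = q • (f b * K a) := by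
    intro a b h1 h2 h3 h4 h5
    simpa [padj a b h1 h2 h3 h4 h5] using conj_swap _ _ _ (hKf a b h1 (by omega) h3 (by omega))
  have hLadj : ∀ a b, 1 ≤ a → a ≤ p → 1 ≤ b → b ≤ p → (b = a + 1 ∨ b + 1 = a) →
      (↑(K a)⁻¹ : A) * f b = q⁻¹ • (f b * (↑(K a)⁻¹ : A)) := by
    intro a b h1 h2 h3 h4 h5
    simpa [padj a b h1 h2 h3 h4 h5] using
      conj_swap_inv _ _ (zpow_ne_zero _ hq0) _ (hKf a b h1 (by omega) h3 (by omega))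
  have hKself : ∀ a, 1 ≤ a → a ≤ p → (K a : A) * f a = (q^2)⁻¹ • (f a * K a) := by
    intro a h1 h2
    have := conj_swap _ _ _ (hKf a a h1 (by omega) h1 (by omega))
    rw [pself a h1 h2, zpow_neg] at this
    exact_mod_cast this
  have hKβp : (K (p+1) : A) * f p = q^2 • (f p * K (p+1)) := by
    have := conj_swap _ _ _ (hKf (p+1) p (by omega) (by omega) (by omega) (by omega))
    rw [pβp, neg_neg] at this
    exact_mod_cast this
  have hKpβ : (K p : A) * f (p+1) = q^2 • (f (p+1) * K p) := by
    have := conj_swap _ _ _ (hKf p (p+1) (by omega) (by omega) (by omega) (by omega))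
    rw [ppβ, neg_neg] at this
    exact_mod_cast this
  have hKβ0 : ∀ a, 1 ≤ a → a < p → (K (p+1) : A) * f a = f a * K (p+1) := by
    intro a h1 h2
    simpa [pβ0 a h1 h2] using conj_swap _ _ _ (hKf (p+1) a (by omega) (by omega) h1 (by omega))
  have hK0β : ∀ a, 1 ≤ a → a < p → (K a : A) * f (p+1) = f (p+1) * K a := by
    intro a h1 h2
    simpa [p0β a h1 h2] using conj_swap _ _ _ (hKf a (p+1) (by omega) (by omega) (by omega) (by omega))
  -- commutation of e and f
  have hef' : ∀ a b, 1 ≤ a → a ≤ p + 1 → 1 ≤ b → b ≤ p + 1 → b ≠ a → e a * f b = f b * e a :=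
    fun a b h1 h2 h3 h4 h5 => sub_eq_zero.mp (hef a b h1 h2 h3 h4 h5.symm)
  have hefShort' : ∀ a, 1 ≤ a → a ≤ p →
      e a * f a - f a * e a = (q⁻¹ - q⁻¹⁻¹)⁻¹ • ((↑(K a)⁻¹ : A) - (K a : A)) := by
    intro a h1 h2
    rw [hefShort a h1 h2, inv_inv, ← neg_sub q q⁻¹, inv_neg, neg_smul, ← smul_neg, neg_sub]
  have hfcomm' : ∀ a b, 1 ≤ a → a + 2 ≤ b → b ≤ p → f a * f b = f b * f a :=
    fun a b h1 h2 h3 => hfcomm a b h1 (by omega) (by omega) h3 (Or.inl h2)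
  -- the vectors
  set X := iterQComm q f 1 p with hXdef
  set Y := iterQComm q⁻¹ f 1 p with hYdef
  set w := TT f p • v with hw
  set r := (-q)^(p-1) with hr
  have hr0 : r ≠ 0 := pow_ne_zero _ (neg_ne_zero.mpr hq0)
  have hri : (-q⁻¹)^(p-1) = r⁻¹ := by rw [hr, ← inv_pow, inv_neg]
  have hfv' : ∀ a, 2 ≤ a → a ≤ p → f a • v = 0 := fun a h1 h2 => hfv a h1 (by omega)
  have hkill := kill_TT (q + q⁻¹) hqs f p hfcomm hfserre v hfv'
  have hXv : X • v = r • w := iter_TT q f p hp hfcomm' v hfv'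
  have hYv : Y • v = r⁻¹ • w := by rw [← hri]; exact iter_TT q⁻¹ f p hp hfcomm' v hfv'
  have hfw : ∀ a, 2 ≤ a → a ≤ p → f a • w = 0 := hkill p le_rfl
  have hXw : X • w = r • TT f p • w := iter_TT q f p hp hfcomm' w hfw
  have hYw : Y • w = r⁻¹ • TT f p • w := by rw [← hri]; exact iter_TT q⁻¹ f p hp hfcomm' w hfw
  have hβv : f (p+1) • v = 0 := hfv (p+1) (by omega) le_rfl
  have hδ : (qComm (q ^ 2) X (qComm ((q ^ 2)⁻¹) Y (f (p + 1)))) • v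
      = f (p+1) • Y • X • v - (q^2)⁻¹ • X • f (p+1) • Y • v - q^2 • Y • f (p+1) • X • v := by
    simp only [qComm, sub_smul, mul_smul, smul_assoc, hβv, smul_zero, zero_sub, smul_sub, smul_neg]
    simp only [smul_comm (_ : A) (_ : k), smul_smul (_ : k) (_ : k), mul_inv_cancel₀ (pow_ne_zero 2 hq0), one_smul]
    abel
  rw [hδ]
  clear_value w
  have smulK : ∀ (g x y : A), g * x = x * g → ∀ u : M, g • x • u = x • g • u := by
    intro g x _ h u
    rw [← mul_smul, h, mul_smul]
  -- r, c relation
  have hrc : q^2 * r^2 * c^2 = -1 := by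
    have h1 : q^2 * r^2 = q^(2*p) := by
      rw [hr, ← pow_mul, show (p-1)*2 = 2*(p-1) by ring, pow_mul (-q), neg_sq, ← pow_mul, ← pow_add]
      congr 1; omega
    rw [h1, hc2, mul_neg, mul_inv_cancel₀ (pow_ne_zero _ hq0)]
  intro a ha1 hap
  rcases hap.eq_or_lt with rfl | hap
  · -- the long root
    have hcX : ∀ u : M, e (p+1) • X • u = X • e (p+1) • u := smulK _ _ 0 <|
      iter_comm q f _ p 1 hp (fun b h1 h2 => hef' _ _ (by omega) le_rfl h1 (by omega) (by omega))
    have hcY : ∀ u : M, e (p+1) • Y • u = Y • e (p+1) • u := smulK _ _ 0 <|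
      iter_comm q⁻¹ f _ p 1 hp (fun b h1 h2 => hef' _ _ (by omega) le_rfl h1 (by omega) (by omega))
    have hKT : (K (p+1) : A) * TT f p = q^2 • (TT f p * K (p+1)) := by
      obtain ⟨n, rfl⟩ := Nat.exists_eq_add_of_le' hp
      have h2 : (K (n+1+1) : A) * TT f n = TT f n * K (n+1+1) :=
        TT_comm f _ n (fun b h1 h2 => hKβ0 b h1 (by omega))
      rw [TT, ← mul_assoc, hKβp, smul_mul_assoc, mul_assoc, h2, mul_assoc]
    have hKw : (K (p+1) : A) • w = q^2 • w := by
      rw [hw, ← mul_smul, hKT, smul_assoc, mul_smul, hKv _ (by omega) le_rfl]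
    have hKTw : (K (p+1) : A) • TT f p • w = q^4 • TT f p • w := by
      rw [← mul_smul, hKT, smul_assoc, mul_smul, hKw, smul_comm (TT f p), smul_smul]; ring_nf
    have hact : ∀ (s : k) (u : M), s ≠ 0 → (K (p+1) : A) • u = s • u → e (p+1) • u = 0 →
        e (p+1) • f (p+1) • u = ((q ^ 2 - (q ^ 2)⁻¹)⁻¹ * (s - s⁻¹)) • u := by
      intro s u hs h1 h2
      have h3 := congrArg (fun x => x • u) hefLong
      simp only [sub_smul, mul_smul, smul_assoc, h2, h1, unit_inv_smul _ s hs u h1, smul_zero, sub_zero] at h3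
      rw [h3]; module
    have hev' := hev (p+1) ha1 le_rfl
    have hew : e (p+1) • w = 0 := by
      have : w = r⁻¹ • X • v := by rw [hXv, inv_smul_smul₀ hr0]
      rw [this, smul_comm, hcX, hev', smul_zero, smul_zero]
    have heTw : e (p+1) • TT f p • w = 0 := by
      have : TT f p • w = r⁻¹ • X • w := by rw [hXw, inv_smul_smul₀ hr0]
      rw [this, smul_comm, hcX, hew, smul_zero, smul_zero]
    rw [hXv, hYv]
    simp only [smul_sub, smul_comm (_ : A) (_ : k), hcX, hcY, hYw]
    rw [hact _ _ (pow_ne_zero 2 hq0) hKw hew, hact _ _ (pow_ne_zero 4 hq0) hKTw heTw]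
    simp only [smul_comm (_ : A) (_ : k), hXw, hYw, smul_smul (_ : k) (_ : k), ← sub_smul]
    convert zero_smul k _
    rw [inv_mul_cancel₀ hq2]
    have : (q^4 - 1) ≠ 0 := sub_ne_zero.mpr hq4
    field_simp
    ring
  · have hap : a ≤ p := by omega
    have hev' := hev a ha1 (by omega)
    have hcβ : ∀ u : M, e a • f (p+1) • u = f (p+1) • e a • u := smulK _ _ 0 <|
      hef' _ _ ha1 (by omega) (by omega) le_rfl (by omega)
    have hact : ∀ (s : k) (u : M), s ≠ 0 → (K a : A) • u = s • u →
        e a • f a • u = f a • e a • u + ((q - q⁻¹)⁻¹ * (s - s⁻¹)) • u := by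
      intro s u hs h1
      have h3 := congrArg (fun x => x • u) (hefShort a ha1 hap)
      simp only [sub_smul, mul_smul, smul_assoc, h1, unit_inv_smul _ s hs u h1] at h3
      rw [sub_eq_iff_eq_add.mp h3, mul_smul, sub_smul, add_comm]
    rcases hp.eq_or_lt with hp1 | hp2
    · -- p = 1
      subst hp1
      obtain rfl : a = 1 := by omega
      have hX1 : X = f 1 := iterQComm_self _ _ _
      have hY1 : Y = f 1 := iterQComm_self _ _ _
      rw [hX1, hY1]
      have hK1 : (K 1 : A) • f 1 • v = (c * (q^2)⁻¹) • f 1 • v := by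
        rw [← mul_smul, hKself 1 le_rfl le_rfl, smul_assoc, mul_smul, hK1v, smul_comm (f 1), smul_smul, mul_comm]
      have hK2 : (K 1 : A) • f (1+1) • f 1 • v = c • f (1+1) • f 1 • v := by
        rw [← mul_smul, hKpβ, smul_assoc, mul_smul, hK1, smul_comm (f (1+1)), smul_smul]
        congr 1
        field_simp
      have e1 := hact c v hc hK1v
      have e2 := hact _ _ (by positivity) hK1
      have e3 := hact _ _ hc hK2
      simp only [smul_sub, smul_comm (_ : A) (_ : k), hcβ]
      simp only [e2, e3, hcβ, e1, hev', smul_zero, smul_add, smul_comm (_ : A) (_ : k), hβv, zero_add,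
        smul_smul (_ : k) (_ : k), ← sub_smul, ← add_smul]
      convert zero_smul k _
      have hrc' : q^2 * c^2 = -1 := by simpa [hr] using hrc
      generalize (q - q⁻¹)⁻¹ = κ
      field_simp
      linear_combination κ * (1 - q^2) * hrc'
    · rcases ha1.eq_or_lt with ha | ha2
      · -- a = 1
        subst ha
        have hEX : ∀ u : M, e 1 • X • u = X • e 1 • u + iterQComm q f 2 p • (↑(K 1)⁻¹ : A) • u := by
          intro u
          rw [← mul_smul, eF_first q hq1 f p 1 (e 1) (K 1) (↑(K 1)⁻¹ : A)
            (fun b h1 h2 h3 => hef' _ _ le_rfl (by omega) h1 (by omega) h3) (hefShort 1 le_rfl hap)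
            (fun b h1 h2 h3 => hKadj 1 b le_rfl hap h2 h3 h1)
            (fun b h1 h2 h3 => hLadj 1 b le_rfl hap h2 h3 h1)
            (fun b h1 h2 h3 => hKfar 1 b le_rfl hap h2 h3 h1)
            (fun b h1 h2 h3 => hLfar 1 b le_rfl hap h2 h3 h1) le_rfl hp2, add_smul, mul_smul, mul_smul]
        have hEY : ∀ u : M, e 1 • Y • u = Y • e 1 • u + iterQComm q⁻¹ f 2 p • (K 1 : A) • u := by
          intro u
          rw [← mul_smul, eF_first q⁻¹ hqi1 f p 1 (e 1) (↑(K 1)⁻¹ : A) (K 1)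
            (fun b h1 h2 h3 => hef' _ _ le_rfl (by omega) h1 (by omega) h3) (hefShort' 1 le_rfl hap)
            (fun b h1 h2 h3 => hLadj 1 b le_rfl hap h2 h3 h1)
            (fun b h1 h2 h3 => by rw [inv_inv]; exact hKadj 1 b le_rfl hap h2 h3 h1)
            (fun b h1 h2 h3 => hLfar 1 b le_rfl hap h2 h3 h1)
            (fun b h1 h2 h3 => hKfar 1 b le_rfl hap h2 h3 h1) le_rfl hp2, add_smul, mul_smul, mul_smul]
        have hKT : ∀ n, n + 2 ≤ p → (K 1 : A) * TT f (n+2) = q⁻¹ • (TT f (n+2) * K 1) := by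
          intro n
          induction n with
          | zero =>
            intro _
            simp only [TT, mul_one, zero_add]
            rw [← mul_assoc, hKadj 1 2 le_rfl hap (by omega) (by omega) (Or.inl rfl), smul_mul_assoc, mul_assoc,
              hKself 1 le_rfl hap, mul_smul_comm, smul_smul, mul_assoc]
            congr 1
            field_simp
          | succ n ih =>
            intro hn
            rw [show TT f (n+1+2) = f (n+3) * TT f (n+2) from rfl, ← mul_assoc,
              hKfar 1 (n+3) le_rfl hap (by omega) hn (by omega), mul_assoc, ih (by omega), mul_smul_comm, mul_assoc]
        have hKw : (K 1 : A) • w = (c * q⁻¹) • w := by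
          obtain ⟨n, rfl⟩ := Nat.exists_eq_add_of_le' hp2
          rw [hw, ← mul_smul, hKT n le_rfl, smul_assoc, mul_smul, hK1v, smul_comm (TT f _), smul_smul, mul_comm]
        have hKβw : (K 1 : A) • f (p+1) • w = (c * q⁻¹) • f (p+1) • w := by
          rw [← mul_smul, hK0β 1 le_rfl hp2, mul_smul, hKw, smul_comm (f _)]
        have hLβw := unit_inv_smul (K 1) (c * q⁻¹) (mul_ne_zero hc hqi0) _ hKβw
        have hLv := unit_inv_smul (K 1) c hc _ hK1v
        have hFv : iterQComm q f 2 p • v = 0 := iter_kill q f v p 2 hp2 hfv'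
        have hGv : iterQComm q⁻¹ f 2 p • v = 0 := iter_kill q⁻¹ f v p 2 hp2 hfv'
        have hGw : iterQComm q⁻¹ f 2 p • w = 0 := iter_kill q⁻¹ f w p 2 hp2 hfw
        have hFG : iterQComm q⁻¹ f 2 p • f (p+1) • w = iterQComm q f 2 p • f (p+1) • w := by
          apply iter_indep q⁻¹ q f _ p 2 hp2
          intro b h1 h2
          rw [← mul_smul, ← hfβcomm b (by omega) h2, mul_smul, hfw b h1 h2.le, smul_zero]
        have heX : e 1 • X • v = 0 := by
          rw [hEX, hev', hLv, smul_comm _ (_ : k), hFv]; simp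
        have heY : e 1 • Y • v = 0 := by
          rw [hEY, hev', hK1v, smul_comm _ (_ : k), hGv]; simp
        simp only [smul_sub, smul_comm (_ : A) (_ : k), hcβ]
        rw [hEX (f (p+1) • _), hEY (f (p+1) • _), hEY (X • v), hcβ, hcβ, heX, heY, hXv, hYv]
        simp only [smul_comm (_ : A) (_ : k), hKw, hKβw, hLβw, hGw, hFG, smul_zero, zero_add, zero_sub,
          smul_smul (_ : k) (_ : k), ← sub_smul, ← neg_smul]
        convert zero_smul k _
        field_simp
        linear_combination -hrc
      · rcases hap.eq_or_lt with rfl | hlt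
        · -- a = p
          obtain ⟨m, rfl⟩ : ∃ m, a = m + 2 := ⟨a - 2, by omega⟩
          have hm : m + 1 ≤ m + 2 := by omega
          have hEX : ∀ u : M, e (m+2) • X • u = X • e (m+2) • u - (K (m+2) : A) • iterQComm q f 1 (m+1) • u := by
            intro u
            rw [← mul_smul, hXdef, eF_last q hq0 hq1 f (m+1) (e (m+2)) (K (m+2)) (↑(K (m+2))⁻¹ : A)
              (fun b h1 h2 => hef' _ _ ha1 (by omega) h1 (by omega) (by omega)) (hefShort _ ha1 hap)
              (fun h1 => hKadj _ _ ha1 hap h1 hm (Or.inr rfl))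
              (fun h1 => hLadj _ _ ha1 hap h1 hm (Or.inr rfl))
              (fun b h1 h2 => hKfar _ _ ha1 hap h2 (by omega) (by omega)) 1 (by omega) le_rfl,
              sub_smul, mul_smul, mul_smul]
          have hEY : ∀ u : M, e (m+2) • Y • u = Y • e (m+2) • u - (↑(K (m+2))⁻¹ : A) • iterQComm q⁻¹ f 1 (m+1) • u := by
            intro u
            rw [← mul_smul, hYdef, eF_last q⁻¹ hqi0 hqi1 f (m+1) (e (m+2)) (↑(K (m+2))⁻¹ : A) (K (m+2))
              (fun b h1 h2 => hef' _ _ ha1 (by omega) h1 (by omega) (by omega)) (hefShort' _ ha1 hap)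
              (fun h1 => hLadj _ _ ha1 hap h1 hm (Or.inr rfl))
              (fun h1 => by rw [inv_inv]; exact hKadj _ _ ha1 hap h1 hm (Or.inr rfl))
              (fun b h1 h2 => hLfar _ _ ha1 hap h2 (by omega) (by omega)) 1 (by omega) le_rfl,
              sub_smul, mul_smul, mul_smul]
          have hYas : ∀ u : M, Y • u = iterQComm q⁻¹ f 1 (m+1) • f (m+2) • u
              - q⁻¹ • f (m+2) • iterQComm q⁻¹ f 1 (m+1) • u := by
            intro u
            rw [hYdef, iter_assoc q⁻¹ f (m+1) 1 (by omega)
              (fun b h1 h2 => hfcomm' b (m+2) h1 (by omega) le_rfl), sub_smul, smul_assoc, mul_smul, mul_smul]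
          have hTβ : ∀ u : M, f (m+2+1) • TT f (m+1) • u = TT f (m+1) • f (m+2+1) • u := smulK _ _ 0 <|
            TT_comm f _ _ (fun b h1 h2 => hfβcomm b h1 (by omega))
          have hX'β : ∀ u : M, iterQComm q f 1 (m+1) • f (m+2+1) • u = f (m+2+1) • iterQComm q f 1 (m+1) • u :=
            fun u => (smulK _ _ 0 (iter_comm q f _ _ 1 (by omega) (fun b h1 h2 => hfβcomm b h1 (by omega))) u).symm
          have hY'β : ∀ u : M, iterQComm q⁻¹ f 1 (m+1) • f (m+2+1) • u = f (m+2+1) • iterQComm q⁻¹ f 1 (m+1) • u :=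
            fun u => (smulK _ _ 0 (iter_comm q⁻¹ f _ _ 1 (by omega) (fun b h1 h2 => hfβcomm b h1 (by omega))) u).symm
          have hKT' : (K (m+2) : A) * TT f (m+1) = q • (TT f (m+1) * K (m+2)) := by
            have : (K (m+2) : A) * TT f m = TT f m * K (m+2) :=
              TT_comm f _ _ (fun b h1 h2 => hKfar _ b ha1 hap h1 (by omega) (by omega))
            rw [TT, ← mul_assoc, hKadj _ _ ha1 hap (by omega) hm (Or.inr rfl), smul_mul_assoc, mul_assoc, this,
              mul_assoc]
          have hww : w = f (m+2) • TT f (m+1) • v := by rw [hw, TT, mul_smul]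
          obtain ⟨w', hw'⟩ : ∃ w', w' = TT f (m+1) • v := ⟨_, rfl⟩
          obtain ⟨s, hs⟩ : ∃ s, s = (-q)^m := ⟨_, rfl⟩
          have hs0 : s ≠ 0 := by rw [hs]; exact pow_ne_zero _ (neg_ne_zero.mpr hq0)
          have hsi : (-q⁻¹)^m = s⁻¹ := by rw [hs, ← inv_pow, inv_neg]
          have hrs : r = -q * s := by rw [hr, hs, show m + 2 - 1 = m + 1 from rfl, pow_succ]; ring
          rw [← hw'] at hww
          have hfw' : ∀ b, 2 ≤ b → b ≤ m+1 → f b • w' = 0 := by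
            rw [hw']; exact hkill (m+1) hm
          have hact2 : ∀ u : M, (∀ b, 2 ≤ b → b ≤ m+1 → f b • u = 0) →
              iterQComm q f 1 (m+1) • u = s • TT f (m+1) • u ∧
              iterQComm q⁻¹ f 1 (m+1) • u = s⁻¹ • TT f (m+1) • u := by
            intro u hu
            rw [← hsi, hs]
            exact ⟨iter_TT q f (m+1) (by omega) (fun a b h1 h2 h3 => hfcomm' a b h1 h2 (by omega)) u hu,
              iter_TT q⁻¹ f (m+1) (by omega) (fun a b h1 h2 h3 => hfcomm' a b h1 h2 (by omega)) u hu⟩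
          obtain ⟨hX'v, hY'v⟩ := hact2 v (fun b h1 h2 => hfv' b h1 (by omega))
          obtain ⟨hX'w, hY'w⟩ := hact2 w (fun b h1 h2 => hfw b h1 (by omega))
          obtain ⟨hX'w', hY'w'⟩ := hact2 w' hfw'
          rw [← hw'] at hX'v hY'v
          have hserreT : f (m+2) • TT f (m+1) • w' = (q + q⁻¹) • TT f (m+1) • w := by
            rw [hww, hw']
            exact serre_TT (q + q⁻¹) hqs f (m+2) hfcomm hfserre v hfv' m le_rfl
          have hβw' : f (m+2+1) • w' = 0 := by rw [hw', hTβ, hβv, smul_zero]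
          have hKw' : (K (m+2) : A) • w' = q • w' := by
            rw [hw', ← mul_smul, hKT', smul_assoc, mul_smul, hKv _ ha2 (by omega)]
          have hLw' := unit_inv_smul _ q hq0 _ hKw'
          have hKw : (K (m+2) : A) • w = q⁻¹ • w := by
            rw [hww, ← mul_smul, hKself _ ha1 hap, smul_assoc, mul_smul, hKw', smul_comm (f _), smul_smul]
            congr 1; field_simp
          have hKTw : (K (m+2) : A) • TT f (m+1) • w = (1:k) • TT f (m+1) • w := by
            rw [← mul_smul, hKT', smul_assoc, mul_smul, hKw, smul_comm (TT f _), smul_smul, mul_inv_cancel₀ hq0]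
          have hLTw := unit_inv_smul _ 1 one_ne_zero _ hKTw
          have hKβTw : (K (m+2) : A) • f (m+2+1) • TT f (m+1) • w = (q^2) • f (m+2+1) • TT f (m+1) • w := by
            rw [← mul_smul, hKpβ, smul_assoc, mul_smul, hKTw, one_smul]
          have hLβTw := unit_inv_smul _ (q^2) (pow_ne_zero 2 hq0) _ hKβTw
          have hYw' : Y • w' = (s⁻¹ * (1 - q⁻¹ * (q + q⁻¹))) • TT f (m+1) • w := by
            rw [hYas, ← hww, hY'w, hY'w', smul_comm (f _), hserreT]
            generalize TT f (m+1) • w = z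
            module
          have heX : e (m+2) • X • v = -(s * q) • w' := by
            rw [hEX, hev', hX'v, smul_comm _ s, hKw']; simp [smul_smul]
          have heY : e (m+2) • Y • v = -(s⁻¹ * q⁻¹) • w' := by
            rw [hEY, hev', hY'v, smul_comm _ s⁻¹, hLw']; simp [smul_smul]
          simp only [smul_sub, smul_comm (_ : A) (_ : k), hcβ]
          rw [hEX (f (m+2+1) • _), hEY (f (m+2+1) • _), hEY (X • v), hcβ, hcβ, heX, heY, hXv, hYv]
          simp only [smul_comm (_ : A) (_ : k), hX'β, hY'β, hX'w, hY'w, hKβTw, hLβTw, hLTw, hYw', hβw',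
            smul_zero, zero_sub, smul_sub, smul_neg, sub_neg_eq_add, smul_smul (_ : k) (_ : k), ← sub_smul,
            ← add_smul, ← neg_smul]
          convert zero_smul k _
          rw [hrs]
          field_simp
          ring
        · -- middle
          have hEX : ∀ u : M, e a • X • u = X • e a • u := smulK _ _ 0 <|
            eF_mid q hq0 hq1 f p a (e a) (K a) (↑(K a)⁻¹ : A)
            (fun b h1 h2 h3 => hef' _ _ ha1 (by omega) h1 (by omega) h3) (hefShort a ha1 hap)
            (fun b h1 h2 h3 => hKadj a b ha1 hap h2 h3 h1)
            (fun b h1 h2 h3 => hLadj a b ha1 hap h2 h3 h1)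
            (fun b h1 h2 h3 => hKfar a b ha1 hap h2 h3 h1)
            (fun b h1 h2 h3 => hLfar a b ha1 hap h2 h3 h1) hfcomm hlt 1 ha2 le_rfl
          have hEY : ∀ u : M, e a • Y • u = Y • e a • u := smulK _ _ 0 <|
            eF_mid q⁻¹ hqi0 hqi1 f p a (e a) (↑(K a)⁻¹ : A) (K a)
            (fun b h1 h2 h3 => hef' _ _ ha1 (by omega) h1 (by omega) h3) (hefShort' a ha1 hap)
            (fun b h1 h2 h3 => hLadj a b ha1 hap h2 h3 h1)
            (fun b h1 h2 h3 => by rw [inv_inv]; exact hKadj a b ha1 hap h2 h3 h1)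
            (fun b h1 h2 h3 => hLfar a b ha1 hap h2 h3 h1)
            (fun b h1 h2 h3 => hKfar a b ha1 hap h2 h3 h1) hfcomm hlt 1 ha2 le_rfl
          simp only [smul_sub, smul_comm (_ : A) (_ : k), hcβ, hEX, hEY, hev', smul_zero, sub_zero]
end
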